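/- arXiv:2211.03354 — 2 statements merged into one kernel-verified Lean document; each statement's English description precedes it below -/
import Mathlib

section
/- Let ȳ_{λ_1}^{λ_2} ȳ_{λ_2}^{λ_3} ⋯ ȳ_{λ_k}^{λ_{k+1}} be an ascending path of length k ≥ 3 in Q̄_m^n with λ_{i+1} = s_{C_i}(λ_i) for circles C_i of λ_i, such that: C_i is not a circle of λ_{i−1} for 2 ≤ i ≤ k−1; C_k is a circle of each of λ_1, …, λ_k; C_k, as a circle of λ_1, is enclosed in C_1; and C_k, as a circle of λ_i, lies to the left of C_i for 2 ≤ i ≤ k−1. For 1 ≤ i ≤ k−1 set μ_{i+1} := s_{C_k}(λ_i). Assume there is no circle of λ_1 that encloses C_k and is strictly enclosed in C_1. Then exactly two circles of μ_2 are not circles of λ_1; letting E be the one of these two circles lying to the left of the other and setting μ_3′ := s_E(μ_2), the sequence ȳ_{λ_1}^{μ_2} ȳ_{μ_2}^{μ_3′} ȳ_{μ_3′}^{μ_4} ȳ_{μ_4}^{μ_5} ⋯ ȳ_{μ_{k−1}}^{μ_k} ȳ_{μ_k}^{λ_{k+1}} is a path in Q̄_m^n, and both ȳ_{λ_1}^{λ_2}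 ⋯ ȳ_{λ_k}^{λ_{k+1}} − (−1)^{k−1} ȳ_{λ_1}^{μ_2} ȳ_{μ_2}^{μ_3′} ȳ_{μ_3′}^{μ_4} ⋯ ȳ_{μ_{k−1}}^{μ_k} ȳ_{μ_k}^{λ_{k+1}} and the corresponding reversed descending difference x̄_{λ_k}^{λ_{k+1}} ⋯ x̄_{λ_1}^{λ_2} − (−1)^{k−1} x̄_{μ_k}^{λ_{k+1}} x̄_{μ_{k−1}}^{μ_k} ⋯ x̄_{μ_3′}^{μ_4} x̄_{μ_2}^{μ_3′} x̄_{λ_1}^{μ_2} lie in the ideal Ī_m^n. -/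
open scoped Classical

namespace Kh

abbrev Wt (N : ℕ) := Fin N → Bool

variable {N : ℕ}

/-- A weight of type `(m,n)`: `m` downs (`true`) and `n` ups (`false`). -/
def IsWeight (m n : ℕ) (l : Wt N) : Prop :=
  {i : Fin N | l i = true}.ncard = m ∧ {i : Fin N | l i = false}.ncard = n

/-- The height of a weight: sum over downs of the number of ups to the left. -/
noncomputable def height (l : Wt N) : ℕ :=
  ∑ i : Fin N, if l i = true then {j : Fin N | j < i ∧ l j = false}.ncard else 0

/-- Number of positions `t` with `i < t ≤ j` and value `b`. -/
noncomputable def cnt (l : Wt N) (b : Bool) (i j : Fin N) : ℕ :=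
  {t : Fin N | i < t ∧ t ≤ j ∧ l t = b}.ncard

/-- `(i,j)` is a matched pair ("circle") of the standard non-crossing bracket matching
of `l` (reading `true` = ↓ as an opening bracket and `false` = ↑ as a closing bracket):
`l i = ↓`, `l j = ↑`, the segment strictly between `i` and `j` is balanced and every
prefix of it has at least as many ↓'s as ↑'s. -/
def IsCircle (l : Wt N) (i j : Fin N) : Prop :=
  i < j ∧ l i = true ∧ l j = false ∧
    cnt l true i j + 1 = cnt l false i j ∧
    ∀ k : Fin N, i < k → k < j → cnt l false i k ≤ cnt l true i k

/-- `s_C(λ)`: exchange the values of `l` at the two positions of the circle `C = (i,j)`. -/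
def swapC (l : Wt N) (i j : Fin N) : Wt N :=
  fun t => if t = i then l j else if t = j then l i else l t

/-- The circle `(i,j)` encloses the circle `(i',j')`. -/
def Encloses (i j i' j' : Fin N) : Prop := i < i' ∧ j' < j

/-- The circle `(i,j)` lies to the left of the circle `(i',j')`. -/
def LeftOf (i j i' j' : Fin N) : Prop := j < i'

/-- The position `p` is unmatched in `l`. -/
def Unmatched (l : Wt N) (p : Fin N) : Prop :=
  ∀ q : Fin N, ¬ IsCircle l p q ∧ ¬ IsCircle l q p

/-- `def(λ)`: the number of circles of `l`. -/
noncomputable def defect (l : Wt N) : ℕ :=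
  {p : Fin N × Fin N | IsCircle l p.1 p.2}.ncard

/-- One step up in the graph `Γ_m^n`: `m' = s_C(l)` for some circle `C` of `l`. -/
def GammaStep (l m' : Wt N) : Prop :=
  ∃ i j : Fin N, IsCircle l i j ∧ m' = swapC l i j

/-- Adjacency in the graph `Γ_m^n`. -/
def GammaAdj (l m' : Wt N) : Prop := GammaStep l m' ∨ GammaStep m' l

/-- The order embedding `Fin N → Fin (N+2)` skipping the two positions `i`, `i+1`;
composing a weight with it deletes these two positions. -/
def skip2 (i : ℕ) {N : ℕ} (t : Fin N) : Fin (N + 2) :=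
  if (t : ℕ) < i then Fin.castLE (Nat.le_add_right N 2) t
  else ⟨(t : ℕ) + 2, Nat.add_lt_add_right t.isLt 2⟩

end Kh

namespace Kh

variable {N : ℕ}

/-- Type (I) elements of `S_m^n`: an ascending arrow into a vertex followed by a
descending arrow out of it (as vertex lists of the corresponding paths in `Q̄_m^n`). -/
def SType1 (p : List (Wt N)) : Prop :=
  ∃ x y z : Wt N, p = [x, y, z] ∧ GammaStep x y ∧ GammaStep z y

/-- Ascending type (II) elements of `S_m^n`: `ȳ_λ^ν ȳ_ν^μ` with `ν = s_C(λ)`,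
`μ = s_{C'}(ν)`, where `C'` is a circle of `λ` enclosed in `C` or lying to the right
of `C`. -/
def SType2Asc (p : List (Wt N)) : Prop :=
  ∃ (la : Wt N) (i j i' j' : Fin N),
    IsCircle la i j ∧ IsCircle la i' j' ∧
    (Encloses i j i' j' ∨ LeftOf i j i' j') ∧
    IsCircle (swapC la i j) i' j' ∧
    p = [la, swapC la i j, swapC (swapC la i j) i' j']

/-- Ascending type (III) elements of `S_m^n` (length `k ≥ 3`), written with 0-based
vertices `v 0, …, v k` (so `λ_t = v (t-1)`) and 1-based circles `C_i = (a i, b i)`. -/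
def SType3Asc (p : List (Wt N)) : Prop :=
  ∃ (k : ℕ) (v : ℕ → Wt N) (a b : ℕ → Fin N),
    3 ≤ k ∧
    p = List.ofFn (fun t : Fin (k + 1) => v t.val) ∧
    (∀ i, 1 ≤ i → i ≤ k →
      IsCircle (v (i - 1)) (a i) (b i) ∧ v i = swapC (v (i - 1)) (a i) (b i)) ∧
    (∀ i, 2 ≤ i → i ≤ k - 1 → ¬ IsCircle (v (i - 2)) (a i) (b i)) ∧
    (∀ j, 1 ≤ j → j ≤ k → IsCircle (v (j - 1)) (a k) (b k)) ∧
    Encloses (a 1) (b 1) (a k) (b k) ∧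
    (∀ i, 2 ≤ i → i ≤ k - 1 → LeftOf (a k) (b k) (a i) (b i))

/-- Membership in the reduction set `S_m^n` (vertex-list model: the descending
elements are the reverses of the ascending ones). -/
def InS (p : List (Wt N)) : Prop :=
  SType1 p ∨ SType2Asc p ∨ SType2Asc p.reverse ∨ SType3Asc p ∨ SType3Asc p.reverse

/-- A path in `Q̄_m^n` (given by its vertex list) is irreducible if no contiguous
subpath of it belongs to `S_m^n`. -/
def Irreducible (p : List (Wt N)) : Prop :=
  ∀ s, s <:+: p → ¬ InS s

/-- The number of ascending irreducible paths of length `k` from `la` to `mu`. -/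
noncomputable def ascCount (k : ℕ) (la mu : Wt N) : ℕ :=
  {p : List (Wt N) | p.length = k + 1 ∧ p.head? = some la ∧ p.getLast? = some mu ∧
    p.Chain' GammaStep ∧ Irreducible p}.ncard

/-- The total number of irreducible paths from `la` to `mu`. -/
noncomputable def irrCount (la mu : Wt N) : ℕ :=
  {p : List (Wt N) | p ≠ [] ∧ p.head? = some la ∧ p.getLast? = some mu ∧
    p.Chain' GammaAdj ∧ Irreducible p}.ncard

end Kh

namespace Kh

/-- The vertex set of `Q̄_m^n`: weights of type `(m,n)`. -/
def V (m n N : ℕ) := {l : Wt N // IsWeight m n l}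

/-- The arrow set of `Q̄_m^n`: for adjacent weights there is one arrow in each
direction (the ascending arrow `ȳ` and the descending arrow `x̄`); an arrow is an
ordered adjacent pair (source, target). -/
def E (m n N : ℕ) := {p : V m n N × V m n N // GammaAdj p.1.1 p.2.1}

/-- The free algebra on the vertices and arrows of `Q̄_m^n`; the path algebra
`kQ̄_m^n` is its quotient by the path-algebra relations `PARel`. -/
abbrev FA (F : Type*) [Field F] (m n N : ℕ) := FreeAlgebra F (V m n N ⊕ E m n N)

noncomputable def eV (F : Type*) [Field F] (m n N : ℕ) (v : V m n N) : FA F m n N :=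
  FreeAlgebra.ι F (Sum.inl v)

noncomputable def arE (F : Type*) [Field F] (m n N : ℕ) (a : E m n N) : FA F m n N :=
  FreeAlgebra.ι F (Sum.inr a)

/-- The idempotent `e_λ` attached to an arbitrary `l : Wt N` (zero if `l` is not
a weight of type `(m,n)`). -/
noncomputable def eW (F : Type*) [Field F] (m n N : ℕ) (l : Wt N) : FA F m n N :=
  if h : IsWeight m n l then eV F m n N ⟨l, h⟩ else 0

/-- The arrow from `u` to `w` (zero if `u`, `w` are not adjacent weights). -/
noncomputable def arW (F : Type*) [Field F] (m n N : ℕ) (u w : Wt N) : FA F m n N :=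
  if h : IsWeight m n u ∧ IsWeight m n w ∧ GammaAdj u w then
    arE F m n N ⟨(⟨u, h.1⟩, ⟨w, h.2.1⟩), h.2.2⟩
  else 0

/-- The element of the (free algebra presenting the) path algebra corresponding to
the path with the given vertex list. -/
noncomputable def pathEl (F : Type*) [Field F] (m n N : ℕ) : List (Wt N) → FA F m n N
  | [] => 0
  | [u] => eW F m n N u
  | u :: w :: rest => arW F m n N u w * pathEl F m n N (w :: rest)

/-- The defining relations of the path algebra `kQ̄_m^n` as a quotient of the free
algebra on vertices and arrows: the vertices are orthogonal idempotents summing to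
`1` and each arrow is supported at its source and target. -/
inductive PARel (F : Type*) [Field F] (m n N : ℕ) : FA F m n N → FA F m n N → Prop
  | idem (v : V m n N) : PARel F m n N (eV F m n N v * eV F m n N v) (eV F m n N v)
  | orth (v w : V m n N) (h : v ≠ w) : PARel F m n N (eV F m n N v * eV F m n N w) 0
  | src (a : E m n N) :
      PARel F m n N (eV F m n N a.1.1 * arE F m n N a) (arE F m n N a)
  | tgt (a : E m n N) :
      PARel F m n N (arE F m n N a * eV F m n N a.1.2) (arE F m n N a)
  | srcZero (v : V m n N) (a : E m n N) (h : v ≠ a.1.1) :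
      PARel F m n N (eV F m n N v * arE F m n N a) 0
  | tgtZero (a : E m n N) (v : V m n N) (h : v ≠ a.1.2) :
      PARel F m n N (arE F m n N a * eV F m n N v) 0
  | unit : PARel F m n N (∑ᶠ v : V m n N, eV F m n N v) 1

/-- The coefficient `c_κ^μ(λ)` where `λ = s_D(κ)` with `D = (d1,d2)`, and
`μ = s_C(λ)` with `C = (i,j)` a circle of `λ`. -/
noncomputable def cCoef {N : ℕ} (ka : Wt N) (d1 d2 i j : Fin N) : ℤ :=
  if IsCircle ka i j then
    if Encloses i j d1 d2 then
      (-1) ^ ({p : Fin N × Fin N |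
        IsCircle ka p.1 p.2 ∧ Encloses p.1 p.2 d1 d2 ∧ Encloses i j p.1 p.2}.ncard) * 2
    else 0
  else 1

/-- Generator of type (A): the sum of all length-2 paths from `la` to `mu`. -/
noncomputable def GenA (F : Type*) [Field F] (m n N : ℕ) (la mu : Wt N) : FA F m n N :=
  ∑ᶠ nu : Wt N, arW F m n N la nu * arW F m n N nu mu

/-- Generator of type (D): `ȳ_λ^μ x̄_λ^μ + Σ_κ c_κ^μ(λ) x̄_κ^λ ȳ_κ^λ`, for `λ` a
weight with circle `C = (i,j)` and `μ = s_C(λ)`. -/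
noncomputable def GenD (F : Type*) [Field F] (m n N : ℕ) (la : Wt N) (i j : Fin N) :
    FA F m n N :=
  arW F m n N la (swapC la i j) * arW F m n N (swapC la i j) la +
    ∑ᶠ ka : Wt N, ∑ᶠ d1 : Fin N, ∑ᶠ d2 : Fin N,
      if IsCircle ka d1 d2 ∧ la = swapC ka d1 d2 then
        cCoef ka d1 d2 i j • (arW F m n N la ka * arW F m n N ka la)
      else 0

/-- The relations presenting `K̄_m^n = kQ̄_m^n / Ī_m^n`: the path-algebra relations
together with the quadratic generators (A)–(D) of the ideal `Ī_m^n`. -/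
inductive KbarRel (F : Type*) [Field F] (m n N : ℕ) : FA F m n N → FA F m n N → Prop
  | pa {x y : FA F m n N} : PARel F m n N x y → KbarRel F m n N x y
  | genA (la mu : Wt N) (h1 : IsWeight m n la) (h2 : IsWeight m n mu) (hne : la ≠ mu)
      (htwo : 2 ≤ {nu : Wt N | GammaAdj la nu ∧ GammaAdj nu mu}.ncard) :
      KbarRel F m n N (GenA F m n N la mu) 0
  | genB1 (la : Wt N) (h : IsWeight m n la) (i j i' j' : Fin N)
      (hC : IsCircle la i j) (hC' : IsCircle la i' j') (henc : Encloses i j i' j')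
      (hno : ¬ ∃ a b : Fin N, IsCircle la a b ∧ Encloses a b i' j' ∧ Encloses i j a b) :
      KbarRel F m n N
        (arW F m n N la (swapC la i j) *
          arW F m n N (swapC la i j) (swapC (swapC la i j) i' j')) 0
  | genB2 (la : Wt N) (h : IsWeight m n la) (i j i' j' : Fin N)
      (hC : IsCircle la i j) (hC' : IsCircle la i' j') (henc : Encloses i j i' j')
      (hno : ¬ ∃ a b : Fin N, IsCircle la a b ∧ Encloses a b i' j' ∧ Encloses i j a b) :
      KbarRel F m n N
        (arW F m n N (swapC (swapC la i j) i' j') (swapC la i j) *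
          arW F m n N (swapC la i j) la) 0
  | genC (la mu : Wt N) (h1 : IsWeight m n la) (h2 : IsWeight m n mu) (hne : la ≠ mu)
      (c1 c2 d1 d2 : Fin N) (hC : IsCircle la c1 c2) (hC'' : IsCircle mu d1 d2)
      (hsw : swapC la c1 c2 = swapC mu d1 d2)
      (hcross : (c1 < d1 ∧ d1 < c2 ∧ c2 < d2) ∨ (d1 < c1 ∧ c1 < d2 ∧ d2 < c2)) :
      KbarRel F m n N
        (arW F m n N la (swapC la c1 c2) * arW F m n N (swapC la c1 c2) mu) 0
  | genD (la : Wt N) (h : IsWeight m n la) (i j : Fin N) (hC : IsCircle la i j) :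
      KbarRel F m n N (GenD F m n N la i j) 0

/-- The Koszul dual `K̄_m^n` of the extended Khovanov arc algebra, presented as a
quotient of the free algebra on the vertices and arrows of `Q̄_m^n`. -/
abbrev Kbar (F : Type*) [Field F] (m n N : ℕ) := RingQuot (KbarRel F m n N)

/-- The canonical projection; an element of the path algebra lies in the ideal
`Ī_m^n` if and only if its image under this map is zero. -/
noncomputable def toKbar (F : Type*) [Field F] (m n N : ℕ) :
    FA F m n N →ₐ[F] Kbar F m n N :=
  RingQuot.mkAlgHom F (KbarRel F m n N)

/-- The degree-`i` component of `K̄_m^n` (image of the span of the length-`i` paths). -/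
noncomputable def degComp (F : Type*) [Field F] (m n N : ℕ) (i : ℕ) :
    Submodule F (Kbar F m n N) :=
  Submodule.span F {x : Kbar F m n N | ∃ p : List (Wt N),
    p.length = i + 1 ∧ (∀ v ∈ p, IsWeight m n v) ∧ p.Chain' GammaAdj ∧
    x = toKbar F m n N (pathEl F m n N p)}

/-- The linear map `x ↦ e_λ x e_μ` on `K̄_m^n`. -/
noncomputable def sandwich (F : Type*) [Field F] (m n N : ℕ) (la mu : Wt N) :
    Kbar F m n N →ₗ[F] Kbar F m n N :=
  (LinearMap.mulLeft F (toKbar F m n N (eW F m n N la))).comp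
    (LinearMap.mulRight F (toKbar F m n N (eW F m n N mu)))

end Kh

namespace Kh

section helpers
variable {N : ℕ}

/-- Partial sums of the weight, with downs counting `+1` and ups `-1`. -/
noncomputable def S (l : Wt N) (t : ℕ) : ℤ :=
  ∑ x : Fin N, if (x : ℕ) < t then (if l x = true then 1 else -1) else 0

lemma S_succ (l : Wt N) (i : Fin N) :
    S l ((i : ℕ) + 1) = S l i + (if l i = true then 1 else -1) := by
  unfold S
  have h : ∀ x : Fin N, (if (x : ℕ) < (i : ℕ) + 1 then (if l x = true then (1 : ℤ) else -1) else 0)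
      = (if (x : ℕ) < (i : ℕ) then (if l x = true then (1 : ℤ) else -1) else 0)
        + (if x = i then (if l i = true then 1 else -1) else 0) := by
    intro x
    by_cases hx : x = i
    · subst hx; simp
    · have : (x : ℕ) ≠ i := fun h => hx (Fin.ext h)
      have h2 : ((x : ℕ) < (i : ℕ) + 1) ↔ ((x : ℕ) < i) := by omega
      simp [hx, h2]
  rw [Finset.sum_congr rfl (fun x _ => h x), Finset.sum_add_distrib]
  simp

lemma S_cnt (l : Wt N) (i j : Fin N) (hij : i ≤ j) :
    S l ((j : ℕ) + 1) = S l ((i : ℕ) + 1) + (cnt l true i j : ℤ) - (cnt l false i j : ℤ) := by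
  have hc : ∀ b, (cnt l b i j : ℤ) = ∑ x : Fin N, if (i < x ∧ x ≤ j ∧ l x = b) then (1 : ℤ) else 0 := by
    intro b
    unfold cnt
    rw [Set.ncard_eq_toFinset_card']
    simp
  rw [hc, hc]
  unfold S
  rw [← Finset.sum_add_distrib, ← Finset.sum_sub_distrib]
  apply Finset.sum_congr rfl
  intro x _
  have : (i : ℕ) ≤ j := hij
  simp only [Fin.lt_def, Fin.le_def]
  cases l x <;> simp <;> split_ifs <;> omega

lemma circle_iff (l : Wt N) (i j : Fin N) :
    IsCircle l i j ↔ i < j ∧ S l ((j : ℕ) + 1) = S l i ∧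
      ∀ t : ℕ, (i : ℕ) < t → t ≤ j → S l i < S l t := by
  constructor
  · rintro ⟨h1, h2, h3, h4, h5⟩
    have e1 := S_succ l i
    have e2 := S_cnt l i j h1.le
    simp only [h2, if_true] at e1
    refine ⟨h1, by omega, ?_⟩
    intro t ht1 ht2
    rcases Nat.eq_or_lt_of_le (Nat.succ_le_of_lt ht1) with h | h
    · rw [← h]; simp only [Nat.succ_eq_add_one]; omega
    · have hx : t - 1 < N := by have := j.isLt; omega
      have h6 := h5 ⟨t - 1, hx⟩ (by rw [Fin.lt_def]; simp; omega) (by rw [Fin.lt_def]; simp; omega)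
      have e3 := S_cnt l i ⟨t - 1, hx⟩ (by rw [Fin.le_def]; simp; omega)
      have : t - 1 + 1 = t := by omega
      simp only [this] at e3
      omega
  · rintro ⟨h1, h2, h3⟩
    have h1' : (i : ℕ) < j := h1
    have e1 := S_succ l i
    have e2 := S_succ l j
    have e3 := S_cnt l i j h1.le
    have f1 := h3 (i + 1) (by omega) (by omega)
    have f2 := h3 j (by omega) (by omega)
    have li : l i = true := by
      by_contra hh
      simp only [hh] at e1
      simp at e1; omega
    have lj : l j = false := by
      by_contra hh
      simp only [Bool.not_eq_false] at hh
      simp only [hh] at e2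
      simp at e2; omega
    simp only [li, if_true] at e1
    refine ⟨h1, li, lj, by omega, ?_⟩
    intro t ht1 ht2
    have ht1' : (i : ℕ) < t := ht1
    have ht2' : (t : ℕ) < j := ht2
    have e4 := S_cnt l i t ht1.le
    have f3 := h3 (t + 1) (by omega) (by omega)
    omega

lemma S_swap (l : Wt N) (i j : Fin N) (hij : i < j) (hi : l i = true) (hj : l j = false) (t : ℕ) :
    S (swapC l i j) t = S l t - (if (i : ℕ) < t ∧ t ≤ j then 2 else 0) := by
  unfold S swapC
  have hne : i ≠ j := ne_of_lt hij
  have hij' : (i : ℕ) < j := hij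
  have h : ∀ x : Fin N, (if (x : ℕ) < t then (if (if x = i then l j else if x = j then l i else l x) = true then (1 : ℤ) else -1) else 0)
      = (if (x : ℕ) < t then (if l x = true then (1 : ℤ) else -1) else 0)
        + ((if x = i then (if (i : ℕ) < t then -2 else 0) else 0) + (if x = j then (if (j : ℕ) < t then 2 else 0) else 0)) := by
    intro x
    by_cases hx : x = i
    · subst hx; simp [hi, hj, hne]; split_ifs <;> simp
    · by_cases hx2 : x = j
      · subst hx2; simp [hi, hj, hx]; split_ifs <;> simp
      · simp [hx, hx2]
  rw [Finset.sum_congr rfl (fun x _ => h x), Finset.sum_add_distrib, Finset.sum_add_distrib]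
  simp only [Finset.sum_ite_eq', Finset.mem_univ, if_true]
  split_ifs <;> omega

lemma S_swap_circle {l : Wt N} {i j : Fin N} (h : IsCircle l i j) (t : ℕ) :
    S (swapC l i j) t = S l t - (if (i : ℕ) < t ∧ t ≤ j then 2 else 0) :=
  S_swap l i j h.1 h.2.1 h.2.2.1 t

/-- unit steps -/
lemma S_step (l : Wt N) (t : ℕ) (ht : t < N) : S l (t + 1) = S l t + 1 ∨ S l (t + 1) = S l t - 1 := by
  have := S_succ l ⟨t, ht⟩
  simp only at this
  split_ifs at this <;> omega

lemma circle_right_unique {l : Wt N} {i j j' : Fin N} (h : IsCircle l i j) (h' : IsCircle l i j') :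
    j = j' := by
  rw [circle_iff] at h h'
  obtain ⟨h1, h2, h3⟩ := h
  obtain ⟨h1', h2', h3'⟩ := h'
  rcases lt_trichotomy j j' with hh | hh | hh
  · have hh' : (j : ℕ) < j' := hh
    have g : (i : ℕ) < j := h1
    have := h3' (j + 1) (by omega) (by omega)
    omega
  · exact hh
  · have hh' : (j' : ℕ) < j := hh
    have g : (i : ℕ) < j' := h1'
    have := h3 (j' + 1) (by omega) (by omega)
    omega

lemma circle_left_unique {l : Wt N} {i i' j : Fin N} (h : IsCircle l i j) (h' : IsCircle l i' j) :
    i = i' := by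
  rw [circle_iff] at h h'
  obtain ⟨h1, h2, h3⟩ := h
  obtain ⟨h1', h2', h3'⟩ := h'
  rcases lt_trichotomy i i' with hh | hh | hh
  · have hh' : (i : ℕ) < i' := hh
    have g : (i' : ℕ) < j := h1'
    have := h3 i' (by omega) (by omega)
    omega
  · exact hh
  · have hh' : (i' : ℕ) < i := hh
    have g : (i : ℕ) < j := h1
    have := h3' i (by omega) (by omega)
    omega

/-- a new circle after swapping `(i,j)` ends at `i` or starts at `j` -/
lemma new_circle {l : Wt N} {i j c d : Fin N} (h : IsCircle l i j)
    (h' : IsCircle (swapC l i j) c d) (hn : ¬ IsCircle l c d) : d = i ∨ c = j := by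
  have hs := S_swap_circle h
  have hli : (swapC l i j) i = false := by simp [swapC, h.2.2.1]
  have hlj : (swapC l i j) j = true := by
    have := h.1.ne'
    simp [swapC, h.2.1, this]
  have hc := h'.2.1
  have hd := h'.2.2.1
  by_contra hcon
  push Not at hcon
  have n1 : (d : ℕ) ≠ i := fun e => hcon.1 (Fin.ext e)
  have n2 : (c : ℕ) ≠ j := fun e => hcon.2 (Fin.ext e)
  have n3 : (c : ℕ) ≠ i := fun e => by rw [Fin.ext e, hli] at hc; simp at hc
  have n4 : (d : ℕ) ≠ j := fun e => by rw [Fin.ext e, hlj] at hd; simp at hd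
  have hj1 := S_succ (swapC l i j) j
  rw [hlj, if_pos rfl] at hj1
  have hi1 := S_succ (swapC l i j) i
  rw [hli] at hi1
  simp only [Bool.false_eq_true, if_false] at hi1
  rw [circle_iff] at h h' hn
  obtain ⟨h1, h2, h3⟩ := h
  obtain ⟨g1, g2, g3⟩ := h'
  have h1' : (i : ℕ) < j := h1
  have g1' : (c : ℕ) < d := g1
  apply hn
  refine ⟨g1, ?_, ?_⟩
  · -- equal shift at c and d+1
    have a1 := hs (d + 1)
    have a2 := hs c
    have a3 := hs j
    have a4 := hs (i + 1)
    have a5 := hs i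
    have a6 := hs (j + 1)
    have b1 := g3 j
    have b2 := g3 (i + 1)
    have b3 := h3 (d + 1)
    have b4 := h3 c
    split_ifs at a1 a2 a3 a4 a5 a6 <;> omega
  · intro t ht1 ht2
    have a0 := g3 t ht1 ht2
    have a1 := hs t
    have a2 := hs c
    have a3 := hs j
    have a4 := hs (i + 1)
    have a5 := hs i
    have a6 := hs (j + 1)
    have b1 := g3 j
    have b2 := g3 (i + 1)
    have b3 := h3 t
    have b4 := h3 c
    split_ifs at a1 a2 a3 a4 a5 a6 <;> omega

/-- existence of a circle in between, given a too low start -/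
lemma direct_level {l : Wt N} {p q r s : Fin N} (h : IsCircle l p q) (h' : IsCircle l r s)
    (he : Encloses p q r s)
    (hmid : ¬ ∃ x y : Fin N, IsCircle l x y ∧ Encloses x y r s ∧ Encloses p q x y) :
    S l r = S l p + 1 := by
  rw [circle_iff] at h h'
  obtain ⟨h1, h2, h3⟩ := h
  obtain ⟨g1, g2, g3⟩ := h'
  have e1 : (p : ℕ) < r := he.1
  have e2 : (s : ℕ) < q := he.2
  have e3 : (r : ℕ) < s := g1
  by_contra hne
  have hgt : S l p + 2 ≤ S l r := by
    have := h3 r e1 (by omega)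
    omega
  -- last `c < r` with `S c < S r`
  have hl : ∃ c : ℕ, c < r ∧ S l c < S l r ∧ ∀ t : ℕ, c < t → t < r → S l r ≤ S l t := by
    have hex : ∃ u : ℕ, u < r ∧ S l (r - 1 - u) < S l r := by
      refine ⟨r - 1 - p, by omega, ?_⟩
      have : (r : ℕ) - 1 - (r - 1 - p) = p := by omega
      rw [this]; omega
    obtain ⟨k1, k2⟩ := Nat.find_spec hex
    refine ⟨r - 1 - Nat.find hex, by omega, k2, ?_⟩
    intro t ht1 ht2
    by_contra hh
    have := Nat.find_min hex (m := r - 1 - t) (by omega)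
    apply this
    refine ⟨by omega, ?_⟩
    have e : (r : ℕ) - 1 - (r - 1 - t) = t := by omega
    rw [e]; omega
  have hr : ∃ d : ℕ, s < d ∧ d ≤ q ∧ S l (d + 1) < S l r ∧ ∀ t : ℕ, s < t → t ≤ d → S l r ≤ S l t := by
    have hex : ∃ d : ℕ, s < d ∧ S l (d + 1) < S l r := ⟨q, e2, by omega⟩
    obtain ⟨k1, k2⟩ := Nat.find_spec hex
    refine ⟨Nat.find hex, k1, Nat.find_min' hex ⟨e2, by omega⟩, k2, ?_⟩
    intro t ht1 ht2
    by_contra hh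
    by_cases ht : t = s + 1
    · subst ht; omega
    · have := Nat.find_min hex (m := t - 1) (by omega)
      apply this
      refine ⟨by omega, ?_⟩
      have e : t - 1 + 1 = t := by omega
      rw [e]; omega
  obtain ⟨c, c1, c2, c3⟩ := hl
  obtain ⟨d, d1, d2, d3, d4⟩ := hr
  have rN := r.isLt
  have qN := q.isLt
  have cp : (p : ℕ) ≤ c := by
    by_contra hh
    have := c3 p (by omega) e1
    omega
  have lc := S_step l c (by omega)
  have ld := S_step l d (by omega)
  have c4 : S l r ≤ S l (c + 1) := by
    by_cases hh : c + 1 = r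
    · rw [hh]
    · exact c3 _ (by omega) (by omega)
  have d5 := d4 d d1 le_rfl
  have cp' : c ≠ p := by intro hh; rw [hh] at c4 lc; omega
  have dq : d ≠ q := by intro hh; rw [hh] at d5 ld d3; omega
  apply hmid
  refine ⟨⟨c, by omega⟩, ⟨d, by omega⟩, ?_, ⟨c1, d1⟩, ⟨by rw [Fin.lt_def]; simp; omega, by rw [Fin.lt_def]; simp; omega⟩⟩
  rw [circle_iff]
  refine ⟨by rw [Fin.lt_def]; simp; omega, by simp only; omega, ?_⟩
  intro t t1 t2
  simp only at t1 t2 ⊢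
  rcases lt_trichotomy t r with hh | hh | hh
  · have := c3 t t1 hh; omega
  · rw [hh]; omega
  · by_cases hs : t ≤ s
    · have := g3 t hh hs; omega
    · have := d4 t (by omega) t2; omega

lemma gammaAdj_symm {u w : Wt N} (h : GammaAdj u w) : GammaAdj w u := h.symm

/-- an edge as a directed move of a down from `x` to `y` -/
lemma adj_move {la nu : Wt N} (h : GammaAdj la nu) :
    ∃ x y : Fin N, la x = true ∧ la y = false ∧ nu = swapC la x y ∧
      ((x < y ∧ IsCircle la x y) ∨ (y < x ∧ IsCircle nu y x)) := by
  rcases h with ⟨i, j, hc, rfl⟩ | ⟨i, j, hc, rfl⟩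
  · exact ⟨i, j, hc.2.1, hc.2.2.1, rfl, Or.inl ⟨hc.1, hc⟩⟩
  · refine ⟨j, i, ?_, ?_, ?_, Or.inr ⟨hc.1, hc⟩⟩
    · have := hc.1.ne'
      simp [swapC, hc.2.1, this]
    · simp [swapC, hc.2.2.1]
    · funext t
      have := hc.1.ne'
      by_cases h1 : t = i
      · subst h1; simp [swapC, this, this.symm]
      · by_cases h2 : t = j
        · subst h2; simp [swapC, this]
        · simp [swapC, h1, h2]

lemma caseA {la nu mu : Wt N} {r s c d : Fin N} (hrs : IsCircle la r s) (hcd : IsCircle la c d)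
    (hsc : s < c) (hmu : mu = swapC (swapC la c d) r s)
    (h1 : GammaAdj la nu) (h2 : GammaAdj nu mu) :
    nu = swapC la c d ∨ nu = swapC la r s ∨ (nu = swapC la c s ∧ IsCircle nu s c) := by
  obtain ⟨x, y, lx, ly, hnu, hxy⟩ := adj_move h1
  obtain ⟨x', y', nx, ny, hmu2, -⟩ := adj_move h2
  have o1 := hrs.1
  have o2 := hcd.1
  have lr := hrs.2.1
  have ls := hrs.2.2.1
  have lc := hcd.2.1
  have ld := hcd.2.2.1
  have nrc : r ≠ c := (o1.trans hsc).ne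
  have nrs : r ≠ s := o1.ne
  have nrd : r ≠ d := (o1.trans (hsc.trans o2)).ne
  have nsc : s ≠ c := hsc.ne
  have nsd : s ≠ d := (hsc.trans o2).ne
  have ncd : c ≠ d := o2.ne
  have mr : mu r = false := by rw [hmu]; simp [swapC, nrs.symm, nsc, nsd, ls]
  have mc : mu c = false := by rw [hmu]; simp [swapC, nrc.symm, nsc.symm, ld]
  have ms : mu s = true := by rw [hmu]; simp [swapC, nrs.symm, nrc, nrd, lr]
  have md : mu d = true := by rw [hmu]; simp [swapC, nrd.symm, nsd.symm, ncd.symm, lc]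
  have key : ∀ t, mu t = if t = x' then false else if t = y' then true else
      if t = x then false else if t = y then true else la t := by
    intro t
    rw [hmu2]
    have : nu t = if t = x then false else if t = y then true else la t := by
      rw [hnu]; simp [swapC, lx, ly]
    simp only [swapC, nx, ny, this]
  have kr := key r
  have kc := key c
  have ks := key s
  have kd := key d
  have hx : x = r ∨ x = c := by grind
  have hy : y = s ∨ y = d := by grind
  rcases hx with rfl | rfl <;> rcases hy with rfl | rfl
  · exact Or.inr (Or.inl hnu)
  · exfalso
    rcases hxy with ⟨_, h⟩ | ⟨h, _⟩
    · exact nsd (circle_right_unique hrs h)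
    · exact absurd h (o1.trans (hsc.trans o2)).not_gt
  · refine Or.inr (Or.inr ⟨hnu, ?_⟩)
    rcases hxy with ⟨h, _⟩ | ⟨_, h⟩
    · exact absurd h hsc.not_gt
    · exact h
  · exact Or.inl hnu

lemma caseB {la nu mu : Wt N} {p q r s : Fin N} (hpq : IsCircle la p q) (hrs : IsCircle la r s)
    (hpr : p < r)
    (hmu : mu = swapC (swapC la r s) p r)
    (h1 : GammaAdj la nu) (h2 : GammaAdj nu mu) :
    nu = swapC la p q ∨ nu = swapC la r s := by
  obtain ⟨x, y, lx, ly, hnu, hxy⟩ := adj_move h1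
  obtain ⟨x', y', nx, ny, hmu2, hxy'⟩ := adj_move h2
  have o1 := hrs.1
  have lr := hrs.2.1
  have ls := hrs.2.2.1
  have lp := hpq.2.1
  have nrs : r ≠ s := o1.ne
  have npr : p ≠ r := hpr.ne
  have nps : p ≠ s := (hpr.trans o1).ne
  have hm : ∀ t, mu t = if t = p then false else if t = s then true else la t := by
    intro t
    rw [hmu]
    simp only [swapC]
    grind
  have key : ∀ t, mu t = if t = x' then false else if t = y' then true else nu t := by
    intro t
    rw [hmu2]
    simp only [swapC, nx, ny]
  have key2 : ∀ t, nu t = if t = x then false else if t = y then true else la t := by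
    intro t
    rw [hnu]; simp [swapC, lx, ly]
  have hcase : (x = p ∧ y ≠ s ∧ x' = y ∧ y' = s) ∨ (x ≠ p ∧ y = s ∧ x' = p ∧ y' = x) := by
    have a1 := hm p
    have a2 := hm s
    have a3 := hm x
    have a4 := hm y
    have a5 := hm x'
    have a6 := hm y'
    have b1 := key p
    have b2 := key s
    have b3 := key x
    have b4 := key y
    have b5 := key x'
    have b6 := key y'
    have c1 := key2 p
    have c2 := key2 s
    have c3 := key2 x
    have c4 := key2 y
    have c5 := key2 x'
    have c6 := key2 y'
    clear key key2 hm
    by_cases hxp : x = p <;> by_cases hys : y = s <;> by_cases hyx : y = x' <;> by_cases hxy2 : x = y' <;> grind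
  rcases hcase with ⟨rfl, hys, rfl, rfl⟩ | ⟨hxp, rfl, rfl, rfl⟩
  · left
    rcases hxy with ⟨_, h⟩ | ⟨hlt, h⟩
    · rw [hnu, circle_right_unique hpq h]
    · exfalso
      rcases hxy' with ⟨_, h'⟩ | ⟨hlt', _⟩
      · exact nps (circle_right_unique h h')
      · exact absurd (hlt'.trans hlt) (hpr.trans o1).not_gt
  · right
    rcases hxy with ⟨_, h⟩ | ⟨hlt, h⟩
    · rw [hnu, circle_left_unique hrs h]
    · exfalso
      rcases hxy' with ⟨_, h'⟩ | ⟨hlt', _⟩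
      · exact nps (circle_left_unique h' h)
      · exact absurd ((hpr.trans o1).trans hlt) hlt'.not_gt

lemma swapC_eq_comp (l : Wt N) (i j : Fin N) : swapC l i j = l ∘ (Equiv.swap i j) := by
  funext t
  simp only [swapC, Function.comp, Equiv.swap_apply_def]
  split_ifs <;> rfl

lemma isWeight_swap {m n : ℕ} {l : Wt N} (h : IsWeight m n l) (i j : Fin N) :
    IsWeight m n (swapC l i j) := by
  have key : ∀ b, {t : Fin N | swapC l i j t = b}.ncard = {t : Fin N | l t = b}.ncard := by
    intro b
    rw [swapC_eq_comp]
    have : {t : Fin N | (l ∘ (Equiv.swap i j)) t = b} = (Equiv.swap i j) '' {t : Fin N | l t = b} := by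
      ext t
      simp only [Function.comp, Set.mem_setOf_eq, Set.mem_image]
      constructor
      · intro ht; exact ⟨_, ht, by simp⟩
      · rintro ⟨u, hu, rfl⟩; simpa using hu
    rw [this, Set.ncard_image_of_injective _ (Equiv.injective _)]
  exact ⟨(key true).trans h.1, (key false).trans h.2⟩

section alg

variable (F : Type*) [Field F] (m n : ℕ)

/-- image of an arrow in the quotient algebra -/
noncomputable def gK (N : ℕ) (u w : Wt N) : Kbar F m n N := toKbar F m n N (arW F m n N u w)

/-- image of an idempotent in the quotient algebra -/
noncomputable def eK (N : ℕ) (u : Wt N) : Kbar F m n N := toKbar F m n N (eW F m n N u)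

lemma toKbar_rel {x y : FA F m n N} (h : KbarRel F m n N x y) :
    toKbar F m n N x = toKbar F m n N y := RingQuot.mkAlgHom_rel F h

lemma eK_gK {u : Wt N} (w : Wt N) : eK F m n N u * gK F m n N u w = gK F m n N u w := by
  unfold eK gK
  rw [← map_mul]
  unfold eW arW
  split_ifs with h1 h2
  · exact toKbar_rel F m n (KbarRel.pa (PARel.src ⟨(⟨u, h2.1⟩, ⟨w, h2.2.1⟩), h2.2.2⟩))
  · simp
  · tauto
  · simp

lemma gK_eK {u w : Wt N} : gK F m n N u w * eK F m n N w = gK F m n N u w := by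
  unfold eK gK
  rw [← map_mul]
  unfold eW arW
  split_ifs with h1 h2
  · exact toKbar_rel F m n (KbarRel.pa (PARel.tgt ⟨(⟨u, h1.1⟩, ⟨w, h1.2.1⟩), h1.2.2⟩))
  · tauto
  · simp
  · simp

lemma gK_zero {u w : Wt N} (h : ¬ GammaAdj u w) : gK F m n N u w = 0 := by
  unfold gK arW
  rw [dif_neg (by tauto)]
  simp

lemma genA_sum {la mu : Wt N} (h1 : IsWeight m n la) (h2 : IsWeight m n mu) (hne : la ≠ mu)
    (T : Finset (Wt N)) (hT : ∀ nu, GammaAdj la nu → GammaAdj nu mu → nu ∈ T)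
    {n1 n2 : Wt N} (hn : n1 ≠ n2) (a1 : GammaAdj la n1) (a2 : GammaAdj n1 mu)
    (a3 : GammaAdj la n2) (a4 : GammaAdj n2 mu) :
    ∑ nu ∈ T, gK F m n N la nu * gK F m n N nu mu = 0 := by
  have htwo : 2 ≤ {nu : Wt N | GammaAdj la nu ∧ GammaAdj nu mu}.ncard := by
    have : ({n1, n2} : Set (Wt N)).ncard = 2 := Set.ncard_pair hn
    rw [← this]
    apply Set.ncard_le_ncard _ (Set.toFinite _)
    rintro x (rfl | rfl)
    · exact ⟨a1, a2⟩
    · exact ⟨a3, a4⟩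
  have := toKbar_rel F m n (KbarRel.genA la mu h1 h2 hne htwo)
  unfold GenA at this
  rw [finsum_eq_sum_of_fintype, map_sum, map_zero] at this
  rw [← this, eq_comm]
  have hs : ∀ x, toKbar F m n N (arW F m n N la x * arW F m n N x mu)
    = gK F m n N la x * gK F m n N x mu := fun x => map_mul _ _ _
  simp only [hs]
  symm
  apply Finset.sum_subset (Finset.subset_univ T)
  intro x _ hx
  by_cases c1 : GammaAdj la x
  · by_cases c2 : GammaAdj x mu
    · exact absurd (hT x c1 c2) hx
    · rw [gK_zero F m n c2, mul_zero]
  · rw [gK_zero F m n c1, zero_mul]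

end alg

/-- product along a vertex sequence -/
def PP {R : Type*} [Ring R] {X : Type*} (g : X → X → R) (f : ℕ → X) : ℕ → R
  | 0 => 1
  | j + 1 => PP g f j * g (f j) (f (j + 1))

lemma PP_main {R : Type*} [Ring R] {X : Type*} (g : X → X → R) (v M f : ℕ → X) (m3 : X) (k : ℕ)
    (hf0 : f 0 = v 0) (hf1 : f 1 = M 0) (hf2 : f 2 = m3)
    (hf : ∀ t, 2 ≤ t → f (t + 1) = M t)
    (H1 : g (v 0) (v 1) * g (v 1) (M 1) = 0)
    (H2 : g (v 0) (v 1) * g (v 1) m3 + g (v 0) (M 0) * g (M 0) m3 = 0)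
    (H3 : g (v 1) (v 2) * g (v 2) (M 2) + g (v 1) (M 1) * g (M 1) (M 2) + g (v 1) m3 * g m3 (M 2) = 0)
    (H4 : ∀ i, 2 ≤ i → i + 1 ≤ k - 1 →
      g (v i) (v (i + 1)) * g (v (i + 1)) (M (i + 1)) + g (v i) (M i) * g (M i) (M (i + 1)) = 0) :
    ∀ j, 2 ≤ j → j ≤ k - 1 → PP g v j * g (v j) (M j) = (-1) ^ j * PP g f (j + 1) := by
  intro j hj
  induction j, hj using Nat.le_induction with
  | base =>
    intro _
    simp only [PP, hf0, hf1, hf2, one_mul, Nat.reduceAdd, zero_add, hf 2 le_rfl]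
    have e1 : g (v 1) (v 2) * g (v 2) (M 2) = -(g (v 1) (M 1) * g (M 1) (M 2)) - g (v 1) m3 * g m3 (M 2) := by
      rw [← sub_eq_zero, ← H3]; noncomm_ring
    have e2 : g (v 0) (v 1) * g (v 1) m3 = - (g (v 0) (M 0) * g (M 0) m3) :=
      eq_neg_of_add_eq_zero_left H2
    rw [mul_assoc, e1, mul_sub, mul_neg, ← mul_assoc, H1, ← mul_assoc, e2]
    noncomm_ring
  | succ j hj ih =>
    intro hjk
    have ih := ih (by omega)
    have e := eq_neg_of_add_eq_zero_left (H4 j hj hjk)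
    have e2 : PP g f (j + 1 + 1) = PP g f (j + 1) * g (M j) (M (j + 1)) := by
      show PP g f (j + 1) * g (f (j + 1)) (f (j + 1 + 1)) = _
      rw [hf j hj, hf (j + 1) (by omega)]
    show PP g v j * g (v j) (v (j + 1)) * g (v (j + 1)) (M (j + 1)) = _
    rw [mul_assoc, e, mul_neg, ← mul_assoc, ih, e2, pow_succ]
    noncomm_ring

section alg2
variable (F : Type*) [Field F] (m n : ℕ)

lemma pathEl_concat (L : List (Wt N)) (u w : Wt N) :
    toKbar F m n N (pathEl F m n N (L ++ [u, w])) =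
      toKbar F m n N (pathEl F m n N (L ++ [u])) * gK F m n N u w := by
  induction L with
  | nil =>
    simp only [List.nil_append, pathEl, map_mul]
    exact (gK_eK F m n).trans (eK_gK F m n w).symm
  | cons x L ih =>
    cases L with
    | nil =>
      simp only [List.cons_append, List.nil_append, pathEl, map_mul] at ih ⊢
      rw [ih, mul_assoc]
    | cons y L =>
      simp only [List.cons_append, pathEl, map_mul] at ih ⊢
      rw [ih, mul_assoc]

lemma pathEl_ofFn (f : ℕ → Wt N) (k : ℕ) :
    toKbar F m n N (pathEl F m n N (List.ofFn (fun t : Fin (k + 1) => f t.val))) =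
      eK F m n N (f 0) * PP (gK F m n N) f k := by
  induction k with
  | zero => simp [PP, pathEl, eK]
  | succ k ih =>
    have : List.ofFn (fun t : Fin (k + 1 + 1) => f t.val)
        = List.ofFn (fun t : Fin k => f t.val) ++ [f k, f (k + 1)] := by
      rw [List.ofFn_succ', List.ofFn_succ']
      simp
    rw [this, pathEl_concat]
    have h2 : List.ofFn (fun t : Fin k => f t.val) ++ [f k] = List.ofFn (fun t : Fin (k + 1) => f t.val) := by
      rw [List.ofFn_succ']
      simp
    rw [h2, ih, mul_assoc]
    rfl

/-- opposite arrows -/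
noncomputable def gKop (N : ℕ) (u w : Wt N) : (Kbar F m n N)ᵐᵒᵖ := MulOpposite.op (gK F m n N w u)

lemma pathEl_ofFn_rev (f : ℕ → Wt N) (k : ℕ) :
    toKbar F m n N (pathEl F m n N (List.ofFn (fun t : Fin (k + 1) => f t.val)).reverse) =
      (PP (gKop F m n N) f k).unop * eK F m n N (f 0) := by
  induction k with
  | zero => simp [PP, pathEl, eK]
  | succ k ih =>
    have h2 : (List.ofFn (fun t : Fin (k + 1) => f t.val)).reverse = f k :: (List.ofFn (fun t : Fin k => f t.val)).reverse := by
      rw [List.ofFn_succ']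
      simp
    have : (List.ofFn (fun t : Fin (k + 1 + 1) => f t.val)).reverse
        = f (k + 1) :: f k :: (List.ofFn (fun t : Fin k => f t.val)).reverse := by
      rw [← h2, List.ofFn_succ']
      simp
    rw [this]
    simp only [pathEl, map_mul]
    rw [← h2, ih]
    simp only [PP, MulOpposite.unop_mul, gKop, MulOpposite.unop_op, mul_assoc]
    rfl

end alg2

lemma step_start {l0 l l' : Wt N} {p j j' c d : Fin N} (hpj' : p < j') (hpj : p ≤ j) (hjj : j < j')
    (hl : ∀ t : ℕ, S l t = S l0 t - (if (p : ℕ) < t ∧ t ≤ j then 2 else 0))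
    (hl' : ∀ t : ℕ, S l' t = S l0 t - (if (p : ℕ) < t ∧ t ≤ j' then 2 else 0))
    (hj : ∀ t : ℕ, (p : ℕ) < t → t ≤ j → S l0 ((j : ℕ) + 1) < S l0 t)
    (hj' : ∀ t : ℕ, (p : ℕ) < t → t ≤ j' → S l0 ((j' : ℕ) + 1) < S l0 t)
    (hc : IsCircle l' c d) (hn : ¬ IsCircle l c d) (hpc : p < c) : c = j' := by
  rw [circle_iff] at hc hn
  obtain ⟨h1, h2, h3⟩ := hc
  have h1' : (c : ℕ) < d := h1
  have o1 : (p : ℕ) < j' := hpj'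
  have o2 : (p : ℕ) ≤ j := hpj
  have o3 : (j : ℕ) < j' := hjj
  have o4 : (p : ℕ) < c := hpc
  by_contra hne
  have hne' : (c : ℕ) ≠ j' := fun e => hne (Fin.ext e)
  apply hn
  have q1 := S_step l0 j' j'.isLt
  have q2 := hj' j' o1 le_rfl
  have q3 := hj' c o4
  have q4 := hj c o4
  have u1 := h3 j'
  have u2 := h3 (j + 1)
  have w1 := hl' j'
  have w2 := hl' (j + 1)
  have w3 := hl' c
  have w4 := hl' (d + 1)
  have w5 := hl c
  have w6 := hl (d + 1)
  rw [if_pos ⟨o1, le_rfl⟩] at w1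
  -- position of the circle relative to `j` and `j'`
  have hcase : (j' : ℕ) < c ∨ ((d : ℕ) < j' ∧ (j : ℕ) < c) ∨ ((d : ℕ) < j) := by
    by_contra hcon
    have : (c : ℕ) < j' := by omega
    rw [if_pos (by omega)] at w3
    have hd : (d : ℕ) < j' := by
      by_contra hd
      have := u1 (by omega) (by omega)
      have := q3 (by omega)
      omega
    have hcj : (c : ℕ) ≤ j := by omega
    have hjd : (j : ℕ) ≤ d := by omega
    have := q4 hcj
    rw [if_pos (by omega)] at w2
    rw [if_pos (by omega)] at w4
    rcases Nat.eq_or_lt_of_le hjd with e | e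
    · rw [← e] at w4 h2; omega
    · have := u2 (by omega) (by omega)
      omega
  refine ⟨h1, ?_, ?_⟩
  · split_ifs at w3 w4 w5 w6 <;> omega
  · intro t t1 t2
    have x1 := h3 t t1 t2
    have x2 := hl t
    have x3 := hl' t
    split_ifs at w3 w5 x2 x3 <;> omega

lemma step_next {l0 l' : Wt N} {p j' d : Fin N} (hpj' : p < j')
    (hl' : ∀ t : ℕ, S l' t = S l0 t - (if (p : ℕ) < t ∧ t ≤ j' then 2 else 0))
    (hj' : ∀ t : ℕ, (p : ℕ) < t → t ≤ j' → S l0 ((j' : ℕ) + 1) < S l0 t)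
    (hc : IsCircle l' j' d) :
    (∀ t : ℕ, S (swapC l' j' d) t = S l0 t - (if (p : ℕ) < t ∧ t ≤ d then 2 else 0)) ∧
    (∀ t : ℕ, (p : ℕ) < t → t ≤ d → S l0 ((d : ℕ) + 1) < S l0 t) ∧
    S l0 ((d : ℕ) + 1) = S l0 ((j' : ℕ) + 1) - 1 := by
  have hs := S_swap_circle hc
  rw [circle_iff] at hc
  obtain ⟨h1, h2, h3⟩ := hc
  have h1' : (j' : ℕ) < d := h1
  have o1 : (p : ℕ) < j' := hpj'
  have q1 := S_step l0 j' j'.isLt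
  have q2 := hj' j' o1 le_rfl
  have w1 := hl' j'
  have w2 := hl' (d + 1)
  rw [if_pos (by omega)] at w1
  rw [if_neg (by omega)] at w2
  refine ⟨?_, ?_, by omega⟩
  · intro t
    rw [hs, hl']
    split_ifs <;> omega
  · intro t t1 t2
    by_cases ht : t ≤ j'
    · have := hj' t t1 ht
      omega
    · have := h3 t (by omega) t2
      have x := hl' t
      rw [if_neg (by omega)] at x
      omega

/-- the invariant along the path -/
def Inv (v : ℕ → Wt N) (p : Fin N) (i : ℕ) (j : Fin N) : Prop :=
  (∀ t : ℕ, S (v i) t = S (v 0) t - (if (p : ℕ) < t ∧ t ≤ j then 2 else 0)) ∧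
  (∀ t : ℕ, (p : ℕ) < t → t ≤ j → S (v 0) ((j : ℕ) + 1) < S (v 0) t)

lemma inv_all (k : ℕ) (hk : 3 ≤ k) (v : ℕ → Wt N) (a b : ℕ → Fin N)
    (hstep : ∀ i, 1 ≤ i → i ≤ k →
      IsCircle (v (i - 1)) (a i) (b i) ∧ v i = swapC (v (i - 1)) (a i) (b i))
    (hnot : ∀ i, 2 ≤ i → i ≤ k - 1 → ¬ IsCircle (v (i - 2)) (a i) (b i))
    (hps : ∀ i, 2 ≤ i → i ≤ k - 1 → a 1 < a i) :
    ∀ i, i + 2 ≤ k - 1 → Inv v (a 1) (i + 1) (b (i + 1)) ∧ Inv v (a 1) (i + 2) (b (i + 2)) ∧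
      a (i + 2) = b (i + 1) ∧ a 1 < b (i + 1) ∧ b (i + 1) < b (i + 2) ∧
      S (v 0) ((b (i + 2) : ℕ) + 1) = S (v 0) ((b (i + 1) : ℕ) + 1) - 1 := by
  have i1 : Inv v (a 1) 1 (b 1) := by
    obtain ⟨hc, hv⟩ := hstep 1 le_rfl (by omega)
    simp only [Nat.sub_self] at hc hv
    refine ⟨?_, ?_⟩
    · intro t
      rw [hv]
      exact S_swap_circle hc t
    · rw [circle_iff] at hc
      obtain ⟨h1, h2, h3⟩ := hc
      intro t t1 t2
      rw [h2]
      exact h3 t t1 t2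
  have gen : ∀ i j, i + 2 ≤ k - 1 → a 1 < b (i + 1) → a 1 ≤ j → j < b (i + 1) → Inv v (a 1) i j →
      Inv v (a 1) (i + 1) (b (i + 1)) → Inv v (a 1) (i + 2) (b (i + 2)) ∧
      a (i + 2) = b (i + 1) ∧ b (i + 1) < b (i + 2) ∧
      S (v 0) ((b (i + 2) : ℕ) + 1) = S (v 0) ((b (i + 1) : ℕ) + 1) - 1 := by
    intro i j hi o1 o2 o3 hI hI'
    obtain ⟨hc, hv⟩ := hstep (i + 2) (by omega) (by omega)
    have hn := hnot (i + 2) (by omega) hi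
    have hp := hps (i + 2) (by omega) hi
    simp only [Nat.add_sub_cancel, show i + 2 - 1 = i + 1 from rfl] at hc hv hn
    have e := step_start o1 o2 o3 hI.1 hI'.1 hI.2 hI'.2 hc hn hp
    rw [e] at hc hv
    obtain ⟨s1, s2, s3⟩ := step_next o1 hI'.1 hI'.2 hc
    refine ⟨⟨?_, s2⟩, e, hc.1, s3⟩
    rw [hv]
    exact s1
  have o := (hstep 1 le_rfl (by omega)).1.1
  intro i
  induction i with
  | zero =>
    intro hi
    have i0 : Inv v (a 1) 0 (a 1) := by
      refine ⟨fun t => ?_, fun t t1 t2 => ?_⟩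
      · rw [if_neg (by omega)]; simp
      · omega
    obtain ⟨g1, g2, g3, g4⟩ := gen 0 (a 1) hi o le_rfl o i0 i1
    exact ⟨i1, g1, g2, o, g3, g4⟩
  | succ i ih =>
    intro hi
    obtain ⟨x1, x2, x3, x4, x5, x6⟩ := ih (by omega)
    obtain ⟨g1, g2, g3, g4⟩ := gen (i + 1) (b (i + 1)) hi (x4.trans x5) x4.le x5 x1 x2
    exact ⟨x2, g1, g2, x4.trans x5, g3, g4⟩

/-- swapping a circle to the left keeps circles to the right -/
lemma circle_keep {l : Wt N} {r s c d : Fin N} (h : IsCircle l r s) (hsc : s < c)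
    (hc : IsCircle l c d) : IsCircle (swapC l r s) c d := by
  have hs := S_swap_circle h
  have o : (s : ℕ) < c := hsc
  rw [circle_iff] at hc ⊢
  obtain ⟨h1, h2, h3⟩ := hc
  have h1' : (c : ℕ) < d := h1
  refine ⟨h1, ?_, ?_⟩
  · rw [hs, hs, if_neg (by omega), if_neg (by omega)]; omega
  · intro t t1 t2
    have := h3 t t1 t2
    rw [hs, hs, if_neg (by omega), if_neg (by omega)]; omega

lemma swap_comm {l : Wt N} {r s c d : Fin N} (h1 : r ≠ c) (h2 : r ≠ d) (h3 : s ≠ c) (h4 : s ≠ d) :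
    swapC (swapC l r s) c d = swapC (swapC l c d) r s := by
  funext t
  simp only [swapC]
  grind

lemma genA_both (F : Type*) [Field F] (m n : ℕ) {la mu : Wt N} (h1 : IsWeight m n la)
    (h2 : IsWeight m n mu) (hne : la ≠ mu)
    (T : Finset (Wt N)) (hT : ∀ nu, GammaAdj la nu → GammaAdj nu mu → nu ∈ T)
    {n1 n2 : Wt N} (hn : n1 ≠ n2) (a1 : GammaAdj la n1) (a2 : GammaAdj n1 mu)
    (a3 : GammaAdj la n2) (a4 : GammaAdj n2 mu) :
    (∑ nu ∈ T, gK F m n N la nu * gK F m n N nu mu = 0) ∧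
    (∑ nu ∈ T, gK F m n N mu nu * gK F m n N nu la = 0) :=
  ⟨genA_sum F m n h1 h2 hne T hT hn a1 a2 a3 a4,
   genA_sum F m n h2 h1 hne.symm T (fun nu x y => hT nu (gammaAdj_symm y) (gammaAdj_symm x)) hn
    (gammaAdj_symm a2) (gammaAdj_symm a1) (gammaAdj_symm a4) (gammaAdj_symm a3)⟩

lemma swap_swap {l : Wt N} {s c : Fin N} (h : s ≠ c) : swapC (swapC l c s) s c = l := by
  funext t
  by_cases h1 : t = s
  · subst h1; simp [swapC, h.symm]
  · by_cases h2 : t = c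
    · subst h2; simp [swapC, h1, h]
    · simp [swapC, h1, h2]

lemma sum_three {R : Type*} [Ring R] {x y z : Wt N} (h1 : x ≠ y) (h2 : x ≠ z) (h3 : y ≠ z)
    {f : Wt N → R} : ∑ t ∈ ({x, y, z} : Finset (Wt N)), f t = f x + f y + f z := by
  rw [Finset.sum_insert (by simp [h1, h2]), Finset.sum_pair h3, add_assoc]

lemma sign_left {F A : Type*} [Field F] [Ring A] [Algebra F A] (e x : A) (j : ℕ) :
    e * ((-1) ^ j * x) = ((-1 : F) ^ j) • (e * x) := by
  rcases Nat.even_or_odd j with h | h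
  · rw [h.neg_one_pow, h.neg_one_pow, one_mul, one_smul]
  · rw [h.neg_one_pow, h.neg_one_pow, neg_one_mul, neg_one_smul, mul_neg]

lemma sign_right {F A : Type*} [Field F] [Ring A] [Algebra F A] (e : A) (x : Aᵐᵒᵖ) (j : ℕ) :
    ((-1) ^ j * x).unop * e = ((-1 : F) ^ j) • (x.unop * e) := by
  rcases Nat.even_or_odd j with h | h
  · rw [h.neg_one_pow, h.neg_one_pow, one_mul, one_smul]
  · rw [h.neg_one_pow, h.neg_one_pow, neg_one_mul, neg_one_smul, MulOpposite.unop_neg, neg_mul]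

end helpers

set_option maxHeartbeats 2000000

/-- (0-based vertices: `λ_t = v (t-1)`, circles `C_i = (a i, b i)`,
`μ_2 = s_{C_k}(λ_1)`, `μ_{t+1} = s_{C_k}(λ_t)`.)  If no circle of `λ_1` encloses
`C_k` and is strictly enclosed in `C_1`, then exactly two circles of `μ_2` are not
circles of `λ_1`; with `E = (e1,e2)` the left one of the two and
`μ_3' = s_E(μ_2)`, the modified `μ`-path exists in `Q̄_m^n` and the two stated
differences lie in the ideal `Ī_m^n` (i.e. vanish in `K̄_m^n`). -/
theorem statement17 (F : Type*) [Field F] (m n : ℕ) (hm : 1 ≤ m) (hn : 1 ≤ n)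
    (N : ℕ) (hN : N = m + n)
    (k : ℕ) (hk : 3 ≤ k) (v : ℕ → Wt N) (a b : ℕ → Fin N)
    (hw : IsWeight m n (v 0))
    (hstep : ∀ i, 1 ≤ i → i ≤ k →
      IsCircle (v (i - 1)) (a i) (b i) ∧ v i = swapC (v (i - 1)) (a i) (b i))
    (hnot : ∀ i, 2 ≤ i → i ≤ k - 1 → ¬ IsCircle (v (i - 2)) (a i) (b i))
    (hall : ∀ j, 1 ≤ j → j ≤ k → IsCircle (v (j - 1)) (a k) (b k))
    (henc : Encloses (a 1) (b 1) (a k) (b k))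
    (hleft : ∀ i, 2 ≤ i → i ≤ k - 1 → LeftOf (a k) (b k) (a i) (b i))
    (hmid : ¬ ∃ p q : Fin N, IsCircle (v 0) p q ∧ Encloses p q (a k) (b k) ∧
      Encloses (a 1) (b 1) p q) :
    {p : Fin N × Fin N |
      IsCircle (swapC (v 0) (a k) (b k)) p.1 p.2 ∧ ¬ IsCircle (v 0) p.1 p.2}.ncard = 2 ∧
    ∃ e1 e2 f1 f2 : Fin N,
      IsCircle (swapC (v 0) (a k) (b k)) e1 e2 ∧ ¬ IsCircle (v 0) e1 e2 ∧
      IsCircle (swapC (v 0) (a k) (b k)) f1 f2 ∧ ¬ IsCircle (v 0) f1 f2 ∧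
      LeftOf e1 e2 f1 f2 ∧
      ((List.ofFn (fun t : Fin (k + 1) =>
          if t.val = 0 then v 0
          else if t.val = 2 then swapC (swapC (v 0) (a k) (b k)) e1 e2
          else if t.val = k then v k
          else swapC (v (t.val - 1)) (a k) (b k))).Chain' GammaStep ∧
        (∀ x ∈ List.ofFn (fun t : Fin (k + 1) =>
          if t.val = 0 then v 0
          else if t.val = 2 then swapC (swapC (v 0) (a k) (b k)) e1 e2
          else if t.val = k then v k
          else swapC (v (t.val - 1)) (a k) (b k)), IsWeight m n x) ∧
        toKbar F m n N
          (pathEl F m n N (List.ofFn (fun t : Fin (k + 1) => v t.val)) -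
            ((-1 : F) ^ (k - 1)) •
              pathEl F m n N (List.ofFn (fun t : Fin (k + 1) =>
                if t.val = 0 then v 0
                else if t.val = 2 then swapC (swapC (v 0) (a k) (b k)) e1 e2
                else if t.val = k then v k
                else swapC (v (t.val - 1)) (a k) (b k)))) = 0 ∧
        toKbar F m n N
          (pathEl F m n N (List.ofFn (fun t : Fin (k + 1) => v t.val)).reverse -
            ((-1 : F) ^ (k - 1)) •
              pathEl F m n N (List.ofFn (fun t : Fin (k + 1) =>
                if t.val = 0 then v 0
                else if t.val = 2 then swapC (swapC (v 0) (a k) (b k)) e1 e2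
                else if t.val = k then v k
                else swapC (v (t.val - 1)) (a k) (b k))).reverse) = 0) := by
  have hvk : v k = swapC (v (k - 1)) (a k) (b k) := (hstep k (by omega) le_rfl).2
  have hps : ∀ i, 2 ≤ i → i ≤ k - 1 → a 1 < a i := fun i h1 h2 =>
    henc.1.trans ((hall 1 le_rfl (by omega)).1.trans (hleft i h1 h2))
  have inv := inv_all k hk v a b hstep hnot hps
  have hC1 : IsCircle (v 0) (a 1) (b 1) := (hstep 1 le_rfl (by omega)).1
  have hv1 : v 1 = swapC (v 0) (a 1) (b 1) := (hstep 1 le_rfl (by omega)).2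
  have hCk : ∀ i, i ≤ k - 1 → IsCircle (v i) (a k) (b k) := fun i hi =>
    hall (i + 1) (by omega) (by omega)
  have hgt : ∀ i, 2 ≤ i → i ≤ k - 1 → b 1 < b i := by
    intro i hi
    induction i, hi using Nat.le_induction with
    | base => intro _; exact (inv 0 (by omega)).2.2.2.2.1
    | succ i hi ih =>
      intro h
      have := inv (i - 1) (by omega)
      have e1 : i - 1 + 1 = i := by omega
      have e2 : i - 1 + 2 = i + 1 := by omega
      rw [e1, e2] at this
      exact (ih (by omega)).trans this.2.2.2.2.1
  have hai : ∀ i, 1 ≤ i → i + 1 ≤ k - 1 → a (i + 1) = b i := by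
    intro i h1 h2
    have := inv (i - 1) (by omega)
    have e1 : i - 1 + 1 = i := by omega
    have e2 : i - 1 + 2 = i + 1 := by omega
    rw [e1, e2] at this
    exact this.2.2.1
  have hInv : ∀ i, 1 ≤ i → i ≤ k - 1 → Inv v (a 1) i (b i) := by
    intro i h1 h2
    rcases Nat.lt_or_ge i 2 with h | h
    · have : i = 1 := by omega
      subst this
      exact (inv 0 (by omega)).1
    · have := inv (i - 2) (by omega)
      have e1 : i - 2 + 2 = i := by omega
      rw [e1] at this
      exact this.2.1
  have hC2 : IsCircle (v 1) (b 1) (b 2) := by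
    have := (hstep 2 (by omega) (by omega)).1
    rw [hai 1 le_rfl (by omega)] at this
    exact this
  have hv2 : v 2 = swapC (v 1) (b 1) (b 2) := by
    have := (hstep 2 (by omega) (by omega)).2
    rw [hai 1 le_rfl (by omega)] at this
    exact this
  have hy := (inv 0 (by omega)).2.2.2.2.2
  have hylow := (hInv 2 (by omega) (by omega)).2
  have hCk0 := hCk 0 (by omega)
  have lev := direct_level hC1 hCk0 henc hmid
  -- weights along the path
  have hwv : ∀ i, i ≤ k → IsWeight m n (v i) := by
    intro i
    induction i with
    | zero => intro _; exact hw
    | succ i ih =>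
      intro h
      rw [(hstep (i + 1) (by omega) h).2]
      exact isWeight_swap (ih (by omega)) _ _
  obtain ⟨p, hp⟩ : ∃ p, p = a 1 := ⟨_, rfl⟩
  obtain ⟨q, hq⟩ : ∃ q, q = b 1 := ⟨_, rfl⟩
  obtain ⟨r, hr⟩ : ∃ r, r = a k := ⟨_, rfl⟩
  obtain ⟨s, hs⟩ : ∃ s, s = b k := ⟨_, rfl⟩
  obtain ⟨y, hyy⟩ : ∃ y, y = b 2 := ⟨_, rfl⟩
  simp only [← hp, ← hq, ← hr, ← hs] at *
  rw [← hyy] at hC2 hv2 hy hylow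
  have o1 : p < r := henc.1
  have o2 : r < s := hCk0.1
  have o3 : s < q := henc.2
  have o4 : q < y := hC2.1
  have o1' : (p : ℕ) < r := o1
  have o2' : (r : ℕ) < s := o2
  have o3' : (s : ℕ) < q := o3
  have o4' : (q : ℕ) < y := o4
  have npr : p ≠ r := by intro h; rw [h] at o1'; omega
  have nps : p ≠ s := by intro h; rw [h] at o1'; omega
  have npq : p ≠ q := by intro h; rw [h] at o1'; omega
  have npy : p ≠ y := by intro h; rw [h] at o1'; omega
  have nrs : r ≠ s := by intro h; rw [h] at o2'; omega
  have nrq : r ≠ q := by intro h; rw [h] at o2'; omega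
  have nry : r ≠ y := by intro h; rw [h] at o2'; omega
  have nsq : s ≠ q := by intro h; rw [h] at o3'; omega
  have nsy : s ≠ y := by intro h; rw [h] at o3'; omega
  have nqy : q ≠ y := by intro h; rw [h] at o4'; omega
  have lp := hC1.2.1
  have lq := hC1.2.2.1
  have lr := hCk0.2.1
  have ls := hCk0.2.2.1
  have ly : v 0 y = false := by
    have := hC2.2.2.1
    rw [hv1] at this
    simpa [swapC, npy.symm, nqy.symm] using this
  have ci1 := (circle_iff _ _ _).1 hC1
  have cik := (circle_iff _ _ _).1 hCk0
  have Ss : S (v 0) s = S (v 0) r + 1 := by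
    have := S_step (v 0) s s.isLt
    have := cik.2.2 s o2' le_rfl
    have := cik.2.1
    omega
  have SM0 := S_swap_circle hCk0
  have cE : IsCircle (swapC (v 0) r s) p r := by
    rw [circle_iff]
    refine ⟨o1, ?_, ?_⟩
    · have := S_succ (v 0) r
      rw [lr, if_pos rfl] at this
      rw [SM0, SM0, if_pos (by omega), if_neg (by omega)]
      omega
    · intro t t1 t2
      have := ci1.2.2 t t1 (by omega)
      rw [SM0, SM0, if_neg (by omega), if_neg (by omega)]
      omega
  have cF : IsCircle (swapC (v 0) r s) s q := by
    rw [circle_iff]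
    refine ⟨o3, ?_, ?_⟩
    · rw [SM0, SM0, if_neg (by omega), if_pos (by omega)]
      omega
    · intro t t1 t2
      have := ci1.2.2 t (by omega) (by omega)
      rw [SM0, SM0, if_pos (by omega), if_neg (by omega)]
      omega
  have nE : ¬ IsCircle (v 0) p r := fun h => by
    have := h.2.2.1; rw [lr] at this; simp at this
  have nF : ¬ IsCircle (v 0) s q := fun h => by
    have := h.2.1; rw [ls] at this; simp at this
  obtain ⟨m3, hm3⟩ : ∃ m3, m3 = swapC (swapC (v 0) r s) p r := ⟨_, rfl⟩
  have m3t : ∀ t, m3 t = if t = p then false else if t = s then true else v 0 t := by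
    intro t
    rw [hm3]
    simp only [swapC]
    grind
  have Sm3 : ∀ t : ℕ, S m3 t = S (v 0) t - (if (p : ℕ) < t ∧ t ≤ s then 2 else 0) := by
    intro t
    rw [hm3, S_swap_circle cE, SM0]
    split_ifs <;> omega
  have c3a : IsCircle m3 s q := by
    rw [circle_iff]
    refine ⟨o3, ?_, ?_⟩
    · rw [Sm3, Sm3, if_neg (by omega), if_pos (by omega)]
      omega
    · intro t t1 t2
      have := ci1.2.2 t (by omega) (by omega)
      rw [Sm3, Sm3, if_pos (by omega), if_neg (by omega)]
      omega
  have c3b : IsCircle m3 r y := by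
    rw [circle_iff]
    refine ⟨o2.trans (o3.trans o4), ?_, ?_⟩
    · rw [Sm3, Sm3, if_neg (by omega), if_pos (by omega)]
      omega
    · intro t t1 t2
      rw [Sm3, Sm3, if_pos (by omega)]
      by_cases ht : t ≤ s
      · have := cik.2.2 t t1 ht
        rw [if_pos (by omega)]
        omega
      · have := hylow t (by omega) t2
        rw [if_neg (by omega)]
        omega
  have e3a : v 1 = swapC m3 s q := by
    funext t
    rw [hv1]
    simp only [swapC, m3t]
    grind
  have e3c : swapC (v 1) q s = m3 := by
    funext t
    rw [hv1, m3t]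
    simp only [swapC]
    grind
  obtain ⟨M, hM⟩ : ∃ M : ℕ → Wt N, ∀ i, M i = swapC (v i) r s := ⟨fun i => swapC (v i) r s, fun _ => rfl⟩
  have e3b : M 2 = swapC m3 r y := by
    funext t
    rw [hM, hv2, hv1]
    simp only [swapC, m3t]
    grind
  -- values at `r` and `s`
  have vr : ∀ i, i ≤ k - 1 → v i r = true := fun i hi => (hCk i hi).2.1
  have vs : ∀ i, i ≤ k - 1 → v i s = false := fun i hi => (hCk i hi).2.2.1
  have Mr : ∀ i, i ≤ k - 1 → M i r = false := fun i hi => by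
    rw [hM]; simp [swapC, vs i hi]
  have vM : ∀ i j, i ≤ k - 1 → j ≤ k - 1 → v i ≠ M j := fun i j hi hj h => by
    have := congrFun h r
    rw [vr i hi, Mr j hj] at this
    simp at this
  have m3r : m3 r = true := by rw [m3t]; simp [npr.symm, nrs, lr]
  have m3s : m3 s = true := by rw [m3t]; simp [nps.symm]
  have m3p : m3 p = false := by rw [m3t]; simp
  have m3M : ∀ i, i ≤ k - 1 → m3 ≠ M i := fun i hi h => by
    have := congrFun h r
    rw [m3r, Mr i hi] at this
    simp at this
  have m3v : ∀ i, i ≤ k - 1 → m3 ≠ v i := fun i hi h => by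
    have := congrFun h s
    rw [m3s, vs i hi] at this
    simp at this
  -- weights
  have hwM : ∀ i, i ≤ k → IsWeight m n (M i) := fun i hi => by
    rw [hM]; exact isWeight_swap (hwv i hi) _ _
  have hwm3 : IsWeight m n m3 := by
    rw [hm3]; exact isWeight_swap (isWeight_swap hw _ _) _ _
  -- steps
  have g_v : ∀ i, i + 1 ≤ k → GammaStep (v i) (v (i + 1)) := fun i hi =>
    ⟨_, _, (hstep (i + 1) (by omega) hi).1, (hstep (i + 1) (by omega) hi).2⟩
  have g_vM : ∀ i, i ≤ k - 1 → GammaStep (v i) (M i) := fun i hi =>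
    ⟨_, _, hCk i hi, hM i⟩
  have hcomm : ∀ i, 1 ≤ i → i + 1 ≤ k - 1 → M (i + 1) = swapC (M i) (a (i + 1)) (b (i + 1)) := by
    intro i h1 h2
    rw [hM, hM, (hstep (i + 1) (by omega) (by omega)).2]
    have hl : s < a (i + 1) := hleft (i + 1) (by omega) h2
    have hab := (hstep (i + 1) (by omega) (by omega)).1.1
    exact (swap_comm (o2.trans hl).ne (o2.trans (hl.trans hab)).ne hl.ne (hl.trans hab).ne).symm
  have g_M : ∀ i, 1 ≤ i → i + 1 ≤ k - 1 → GammaStep (M i) (M (i + 1)) := by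
    intro i h1 h2
    refine ⟨a (i + 1), b (i + 1), ?_, hcomm i h1 h2⟩
    rw [hM]
    exact circle_keep (hCk i (by omega)) (hleft (i + 1) (by omega) h2)
      (hstep (i + 1) (by omega) (by omega)).1
  have g_M0m3 : GammaStep (M 0) m3 := ⟨p, r, by rw [hM]; exact cE, by rw [hM]; exact hm3⟩
  have g_m3v1 : GammaStep m3 (v 1) := ⟨s, q, c3a, e3a⟩
  have g_m3M2 : GammaStep m3 (M 2) := ⟨r, y, c3b, e3b⟩
  -- relations
  have H2 := genA_both F m n (la := v 0) (mu := m3) hw hwm3 (m3v 0 (by omega)).symm {v 1, M 0}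
    (by
      intro nu h1 h2
      rcases caseB hC1 hCk0 o1 hm3 h1 h2 with h | h
      · rw [← hv1] at h; simp [h]
      · rw [← hM] at h; simp [h])
    (vM 1 0 (by omega) (by omega)) (Or.inl (g_v 0 (by omega))) (Or.inr g_m3v1)
    (Or.inl (g_vM 0 (by omega))) (Or.inl g_M0m3)
  have H3 := genA_both F m n (la := v 1) (mu := M 2) (hwv 1 (by omega)) (hwM 2 (by omega))
    (vM 1 2 (by omega) (by omega)) {v 2, M 1, m3}
    (by
      intro nu h1 h2
      rcases caseA (hCk 1 (by omega)) hC2 o3 (by rw [hM, hv2]) h1 h2 with h | h | ⟨h, -⟩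
      · rw [← hv2] at h; simp [h]
      · rw [← hM] at h; simp [h]
      · rw [e3c] at h; simp [h])
    (vM 2 1 (by omega) (by omega)) (Or.inl (g_v 1 (by omega))) (Or.inl (g_vM 2 (by omega)))
    (Or.inl (g_vM 1 (by omega))) (Or.inl (g_M 1 le_rfl (by omega)))
  have H4 := fun (i : ℕ) (hi : 2 ≤ i) (hik : i + 1 ≤ k - 1) =>
    genA_both F m n (la := v i) (mu := M (i + 1)) (hwv i (by omega)) (hwM (i + 1) (by omega))
    (vM i (i + 1) (by omega) (by omega)) {v (i + 1), M i}
    (by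
      intro nu h1 h2
      obtain ⟨hc, hv⟩ := hstep (i + 1) (by omega) (by omega)
      simp only [Nat.add_sub_cancel] at hc hv
      rcases caseA (hCk i (by omega)) hc (hleft (i + 1) (by omega) hik)
        (by rw [hM, hv]) h1 h2 with h | h | ⟨h, h'⟩
      · rw [← hv] at h; simp [h]
      · rw [← hM] at h; simp [h]
      · exfalso
        rw [hai i (by omega) hik] at h h'
        have hlt : (q : ℕ) < b i := hgt i hi (by omega)
        have hvi : v i = swapC nu s (b i) := by
          have nsb : s ≠ b i := h'.1.ne
          rw [h]
          exact (swap_swap nsb).symm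
        have sw := S_swap_circle h'
        rw [← hvi] at sw
        have iv := (hInv i (by omega) (by omega)).1
        have x1 := sw s
        have x2 := sw (q + 1)
        rw [if_neg (by omega), iv, if_pos (by omega)] at x1
        rw [if_pos (by omega), iv, if_pos (by omega)] at x2
        have x3 := ((circle_iff _ _ _).1 h').2.2 (q + 1) (by omega) (by omega)
        have := ci1.2.1
        omega)
    (vM (i + 1) i (by omega) (by omega)) (Or.inl (g_v i (by omega)))
    (Or.inl (g_vM (i + 1) (by omega)))
    (Or.inl (g_vM i (by omega))) (Or.inl (g_M i (by omega) hik))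
  have hB1 : gK F m n N (v 0) (v 1) * gK F m n N (v 1) (M 1) = 0 := by
    have := toKbar_rel F m n (KbarRel.genB1 (v 0) hw p q r s hC1 hCk0 henc hmid)
    rw [map_mul, map_zero, ← hv1, ← hM] at this
    exact this
  have hB2 : gK F m n N (M 1) (v 1) * gK F m n N (v 1) (v 0) = 0 := by
    have := toKbar_rel F m n (KbarRel.genB2 (v 0) hw p q r s hC1 hCk0 henc hmid)
    rw [map_mul, map_zero, ← hv1, ← hM] at this
    exact this
  rw [Finset.sum_pair (vM 1 0 (by omega) (by omega)), Finset.sum_pair (vM 1 0 (by omega) (by omega))] at H2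
  rw [sum_three (vM 2 1 (by omega) (by omega)) (m3v 2 (by omega)).symm (m3M 1 (by omega)).symm,
    sum_three (vM 2 1 (by omega) (by omega)) (m3v 2 (by omega)).symm (m3M 1 (by omega)).symm] at H3
  obtain ⟨f, hf⟩ : ∃ f : ℕ → Wt N, f = fun t => if t = 0 then v 0 else if t = 2 then m3
      else if t = k then v k else swapC (v (t - 1)) r s := ⟨_, rfl⟩
  have f0 : f 0 = v 0 := by rw [hf]; simp
  have f1 : f 1 = M 0 := by
    rw [hf, hM]
    simp [show (1 : ℕ) ≠ k by omega]
  have f2 : f 2 = m3 := by rw [hf]; simp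
  have fM : ∀ t, 2 ≤ t → f (t + 1) = M t := by
    intro t ht
    rw [hf, hM]
    simp only [Nat.add_sub_cancel]
    rw [if_neg (by omega), if_neg (by omega)]
    split_ifs with h
    · rw [hvk, ← h]; simp
    · rfl
  have vkM : v k = M (k - 1) := by rw [hvk, hM]
  have main1 := PP_main (gK F m n N) v M f m3 k f0 f1 f2 fM hB1 H2.1 H3.1
    (fun i h1 h2 => by
      have := (H4 i h1 h2).1
      rwa [Finset.sum_pair (vM (i + 1) i (by omega) (by omega))] at this)
    (k - 1) (by omega) le_rfl
  have main2 := PP_main (gKop F m n N) v M f m3 k f0 f1 f2 fM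
    (congrArg MulOpposite.op hB2) (congrArg MulOpposite.op H2.2) (congrArg MulOpposite.op H3.2)
    (fun i h1 h2 => by
      have := (H4 i h1 h2).2
      rw [Finset.sum_pair (vM (i + 1) i (by omega) (by omega))] at this
      exact congrArg MulOpposite.op this)
    (k - 1) (by omega) le_rfl
  have ek : k - 1 + 1 = k := by omega
  have P1 : PP (gK F m n N) v k = (-1) ^ (k - 1) * PP (gK F m n N) f k := by
    rw [ek] at main1
    rw [← main1, ← vkM]
    conv_lhs => rw [← ek]
    simp only [PP, ek]
  have P2 : PP (gKop F m n N) v k = (-1) ^ (k - 1) * PP (gKop F m n N) f k := by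
    rw [ek] at main2
    rw [← main2, ← vkM]
    conv_lhs => rw [← ek]
    simp only [PP, ek]
  refine ⟨?_, p, r, s, q, cE, nE, cF, nF, o2, ?_⟩
  · have : {x : Fin N × Fin N | IsCircle (swapC (v 0) r s) x.1 x.2 ∧ ¬ IsCircle (v 0) x.1 x.2}
        = {(p, r), (s, q)} := by
      ext ⟨c, d⟩
      simp only [Set.mem_setOf_eq, Set.mem_insert_iff, Set.mem_singleton_iff, Prod.mk.injEq]
      constructor
      · rintro ⟨h1, h2⟩
        rcases new_circle hCk0 h1 h2 with rfl | rfl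
        · left; exact ⟨circle_left_unique h1 cE, rfl⟩
        · right; exact ⟨rfl, circle_right_unique h1 cF⟩
      · rintro (⟨rfl, rfl⟩ | ⟨rfl, rfl⟩)
        · exact ⟨cE, nE⟩
        · exact ⟨cF, nF⟩
    rw [this]
    apply Set.ncard_pair
    intro h
    exact nps (Prod.mk.inj h).1
  · rw [← hm3]
    have hlist : (List.ofFn (fun t : Fin (k + 1) =>
          if t.val = 0 then v 0
          else if t.val = 2 then m3
          else if t.val = k then v k
          else swapC (v (t.val - 1)) r s)) = List.ofFn (fun t : Fin (k + 1) => f t.val) := by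
      rw [hf]
    rw [hlist]
    have fstep : ∀ t, t < k → GammaStep (f t) (f (t + 1)) := by
      intro t ht
      rcases Nat.lt_or_ge t 3 with h | h
      · interval_cases t
        · rw [f0, f1]; exact g_vM 0 (by omega)
        · rw [f1, f2]; exact g_M0m3
        · rw [f2, fM 2 le_rfl]; exact g_m3M2
      · have e : t = t - 1 + 1 := by omega
        rw [fM t (by omega)]
        have h2 : f t = M (t - 1) := by
          conv_lhs => rw [e]
          exact fM (t - 1) (by omega)
        rw [h2]
        have := g_M (t - 1) (by omega) (by omega)
        rwa [← e] at this
    refine ⟨?_, ?_, ?_, ?_⟩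
    · show List.IsChain _ _
      rw [List.isChain_iff_getElem]
      intro i hi
      simp only [List.getElem_ofFn]
      simp only [List.length_ofFn] at hi
      exact fstep i (by omega)
    · intro x hx
      rw [List.mem_ofFn] at hx
      obtain ⟨⟨t, ht⟩, rfl⟩ := hx
      simp only
      have : ∀ t, t ≤ k → IsWeight m n (f t) := by
        intro t
        induction t with
        | zero => intro _; rw [f0]; exact hw
        | succ t ih =>
          intro h
          obtain ⟨i, j, _, e⟩ := fstep t (by omega)
          rw [e]
          exact isWeight_swap (ih (by omega)) _ _
      exact this t (by omega)
    · rw [map_sub, map_smul, pathEl_ofFn, pathEl_ofFn, P1, f0, sub_eq_zero]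
      exact sign_left _ _ _
    · rw [map_sub, map_smul, pathEl_ofFn_rev, pathEl_ofFn_rev, P2, f0, sub_eq_zero]
      exact sign_right _ _ _

end Kh
end

section
/- Let k be a field and grade kQ_m^n / I_m^n by path length, with degree-2 component the image of the span of the length-2 paths. Then for all weights λ ≠ μ of type (m,n) one has dim_k e_λ (kQ_m^n / I_m^n)_2 e_μ ≤ 1, and for every weight λ one has dim_k e_λ (kQ_m^n / I_m^n)_2 e_λ ≤ def(λ). -/
open scoped Classical

namespace Kh

/-- The relations presenting `kQ_m^n / I_m^n`: the path-algebra relations together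
with the quadratic generators (i)–(iii) of the ideal `I_m^n`.  (In `Q_m^n` the
ascending arrow `λ → μ` is `x_λ^μ` and the descending arrow `μ → λ` is `y_λ^μ`;
arrows are again encoded as ordered adjacent pairs.) -/
inductive KqRel (F : Type*) [Field F] (m n N : ℕ) : FA F m n N → FA F m n N → Prop
  | pa {x y : FA F m n N} : PARel F m n N x y → KqRel F m n N x y
  | genIupX (la : Wt N) (h : IsWeight m n la) (i j p : Fin N)
      (hC : IsCircle la i j) (hum : Unmatched la p) (hval : la p = false)
      (hgt : j < p) (hC2 : IsCircle (swapC la i j) j p) :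
      KqRel F m n N
        (arW F m n N la (swapC la i j) *
          arW F m n N (swapC la i j) (swapC (swapC la i j) j p)) 0
  | genIupY (la : Wt N) (h : IsWeight m n la) (i j p : Fin N)
      (hC : IsCircle la i j) (hum : Unmatched la p) (hval : la p = false)
      (hgt : j < p) (hC2 : IsCircle (swapC la i j) j p) :
      KqRel F m n N
        (arW F m n N (swapC (swapC la i j) j p) (swapC la i j) *
          arW F m n N (swapC la i j) la) 0
  | genIdnX (la : Wt N) (h : IsWeight m n la) (i j p : Fin N)
      (hC : IsCircle la i j) (hum : Unmatched la p) (hval : la p = true)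
      (hlt : p < i) (hC2 : IsCircle (swapC la i j) p i) :
      KqRel F m n N
        (arW F m n N la (swapC la i j) *
          arW F m n N (swapC la i j) (swapC (swapC la i j) p i)) 0
  | genIdnY (la : Wt N) (h : IsWeight m n la) (i j p : Fin N)
      (hC : IsCircle la i j) (hum : Unmatched la p) (hval : la p = true)
      (hlt : p < i) (hC2 : IsCircle (swapC la i j) p i) :
      KqRel F m n N
        (arW F m n N (swapC (swapC la i j) p i) (swapC la i j) *
          arW F m n N (swapC la i j) la) 0
  | genII (la mu nu nu' : Wt N) (h1 : IsWeight m n la) (h2 : IsWeight m n mu)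
      (hne : la ≠ mu) (ha1 : GammaAdj la nu) (ha2 : GammaAdj nu mu)
      (hb1 : GammaAdj la nu') (hb2 : GammaAdj nu' mu) :
      KqRel F m n N
        (arW F m n N la nu * arW F m n N nu mu -
          arW F m n N la nu' * arW F m n N nu' mu) 0
  | genIII (la ka : Wt N) (h : IsWeight m n la) (d1 d2 : Fin N)
      (hD : IsCircle ka d1 d2) (hsw : la = swapC ka d1 d2) :
      KqRel F m n N
        (arW F m n N la ka * arW F m n N ka la -
          ∑ᶠ i : Fin N, ∑ᶠ j : Fin N,
            if IsCircle la i j then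
              cCoef ka d1 d2 i j •
                (arW F m n N la (swapC la i j) * arW F m n N (swapC la i j) la)
            else 0) 0

/-- The extended Khovanov arc algebra presented as `kQ_m^n / I_m^n`. -/
abbrev Kq (F : Type*) [Field F] (m n N : ℕ) := RingQuot (KqRel F m n N)

noncomputable def toKq (F : Type*) [Field F] (m n N : ℕ) :
    FA F m n N →ₐ[F] Kq F m n N :=
  RingQuot.mkAlgHom F (KqRel F m n N)

/-- The degree-2 component of `kQ_m^n / I_m^n` (image of the span of length-2 paths). -/
noncomputable def degQ2 (F : Type*) [Field F] (m n N : ℕ) :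
    Submodule F (Kq F m n N) :=
  Submodule.span F {x : Kq F m n N | ∃ p : List (Wt N),
    p.length = 3 ∧ (∀ v ∈ p, IsWeight m n v) ∧ p.Chain' GammaAdj ∧
    x = toKq F m n N (pathEl F m n N p)}

/-- The linear map `x ↦ e_λ x e_μ` on `kQ_m^n / I_m^n`. -/
noncomputable def sandwichQ (F : Type*) [Field F] (m n N : ℕ) (la mu : Wt N) :
    Kq F m n N →ₗ[F] Kq F m n N :=
  (LinearMap.mulLeft F (toKq F m n N (eW F m n N la))).comp
    (LinearMap.mulRight F (toKq F m n N (eW F m n N mu)))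

section aux
variable (F : Type*) [Field F] (m n N : ℕ)

theorem toKq_rel {x y : FA F m n N} (h : KqRel F m n N x y) :
    toKq F m n N x = toKq F m n N y := RingQuot.mkAlgHom_rel F h

theorem eW_arW (l u w : Wt N) (hl : IsWeight m n l) :
    toKq F m n N (eW F m n N l) * toKq F m n N (arW F m n N u w) =
      if l = u then toKq F m n N (arW F m n N u w) else 0 := by
  rw [← map_mul]
  unfold arW
  split_ifs with h1 h2 h2
  · subst h2
    rw [eW, dif_pos hl]
    exact toKq_rel F m n N (.pa (.src ⟨(⟨l, h1.1⟩, ⟨w, h1.2.1⟩), h1.2.2⟩))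
  · rw [eW, dif_pos hl, ← map_zero (toKq F m n N)]
    refine toKq_rel F m n N (.pa (.srcZero _ _ ?_))
    intro h
    exact h2 (congrArg Subtype.val h)
  · simp
  · simp

theorem arW_eW (l u w : Wt N) (hl : IsWeight m n l) :
    toKq F m n N (arW F m n N u w) * toKq F m n N (eW F m n N l) =
      if l = w then toKq F m n N (arW F m n N u w) else 0 := by
  rw [← map_mul]
  unfold arW
  split_ifs with h1 h2 h2
  · subst h2
    rw [eW, dif_pos hl]
    exact toKq_rel F m n N (.pa (.tgt ⟨(⟨u, h1.1⟩, ⟨l, h1.2.1⟩), h1.2.2⟩))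
  · rw [eW, dif_pos hl, ← map_zero (toKq F m n N)]
    refine toKq_rel F m n N (.pa (.tgtZero _ _ ?_))
    intro h
    exact h2 (congrArg Subtype.val h)
  · simp
  · simp

/-- The image in the quotient of the length-2 path `u → v → w`. -/
noncomputable def two (u v w : Wt N) : Kq F m n N :=
  toKq F m n N (arW F m n N u v) * toKq F m n N (arW F m n N v w)

theorem map_le (la mu : Wt N) (hl : IsWeight m n la) (hmu : IsWeight m n mu)
    (S : Submodule F (Kq F m n N))
    (hS : ∀ v, IsWeight m n v → GammaAdj la v → GammaAdj v mu → two F m n N la v mu ∈ S) :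
    Submodule.map (sandwichQ F m n N la mu) (degQ2 F m n N) ≤ S := by
  unfold degQ2
  rw [Submodule.map_span, Submodule.span_le]
  rintro _ ⟨_, ⟨p, hp, hw, hc, rfl⟩, rfl⟩
  obtain ⟨u, v, w, rfl⟩ := List.length_eq_three.1 hp
  have hu : IsWeight m n u := hw u (by simp)
  have hv : IsWeight m n v := hw v (by simp)
  have hww : IsWeight m n w := hw w (by simp)
  have h1 : GammaAdj u v ∧ GammaAdj v w := by simpa [List.Chain'] using hc
  have key : sandwichQ F m n N la mu (toKq F m n N (pathEl F m n N [u, v, w])) =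
      (toKq F m n N (eW F m n N la) * toKq F m n N (arW F m n N u v)) *
        ((toKq F m n N (arW F m n N v w) * toKq F m n N (eW F m n N w)) *
          toKq F m n N (eW F m n N mu)) := by
    simp [sandwichQ, pathEl, mul_assoc]
  rw [SetLike.mem_coe, key, arW_eW F m n N _ _ _ hww, if_pos rfl, arW_eW F m n N _ _ _ hmu,
    eW_arW F m n N _ _ _ hl]
  split_ifs with h2 h3
  · subst h2 h3
    exact hS v hv h1.1 h1.2
  all_goals simp

theorem finrank_le_of_le_span {M : Type*} [AddCommGroup M] [Module F M] (P : Submodule F M)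
    (s : Set M) (hs : s.Finite) (h : P ≤ Submodule.span F s) :
    Module.finrank F P ≤ s.ncard := by
  haveI := hs.fintype
  haveI : FiniteDimensional F (Submodule.span F s) := FiniteDimensional.span_of_finite F hs
  calc Module.finrank F P ≤ Module.finrank F (Submodule.span F s) := Submodule.finrank_mono h
    _ ≤ s.toFinset.card := finrank_span_le_card s
    _ = s.ncard := (Set.ncard_eq_toFinset_card' s).symm

end aux

/-- For weights `λ ≠ μ`, `dim e_λ (kQ_m^n/I_m^n)_2 e_μ ≤ 1`, and
for every weight `λ`, `dim e_λ (kQ_m^n/I_m^n)_2 e_λ ≤ def(λ)`. -/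
theorem statement19 (F : Type*) [Field F] (m n : ℕ) (hm : 1 ≤ m) (hn : 1 ≤ n)
    (N : ℕ) (hN : N = m + n) :
    (∀ la mu : Wt N, IsWeight m n la → IsWeight m n mu → la ≠ mu →
      Module.finrank F
        ↥(Submodule.map (sandwichQ F m n N la mu) (degQ2 F m n N)) ≤ 1) ∧
    (∀ la : Wt N, IsWeight m n la →
      Module.finrank F
        ↥(Submodule.map (sandwichQ F m n N la la) (degQ2 F m n N)) ≤ defect la) := by
  constructor
  · intro la mu hl hmu hne
    by_cases hex : ∃ v, GammaAdj la v ∧ GammaAdj v mu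
    · obtain ⟨v₀, h1, h2⟩ := hex
      refine (finrank_le_of_le_span F _ {two F m n N la v₀ mu} (Set.finite_singleton _) ?_).trans
        (by simp)
      refine map_le F m n N la mu hl hmu _ fun v _ ha hb => ?_
      have h := toKq_rel F m n N (.genII la mu v v₀ hl hmu hne ha hb h1 h2)
      rw [map_sub, map_zero, sub_eq_zero, map_mul, map_mul] at h
      have h' : two F m n N la v mu = two F m n N la v₀ mu := h
      rw [h']
      exact Submodule.mem_span_singleton_self _
    · refine (finrank_le_of_le_span F _ ∅ Set.finite_empty ?_).trans (by simp)
      exact map_le F m n N la mu hl hmu _ fun v _ ha hb => (hex ⟨v, ha, hb⟩).elim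
  · intro la hl
    let f : Fin N × Fin N → Kq F m n N := fun p => two F m n N la (swapC la p.1 p.2) la
    have hfin : {p : Fin N × Fin N | IsCircle la p.1 p.2}.Finite := Set.toFinite _
    refine (finrank_le_of_le_span F _ (f '' {p : Fin N × Fin N | IsCircle la p.1 p.2})
      (hfin.image f) ?_).trans (Set.ncard_image_le hfin)
    have hf : ∀ i j, IsCircle la i j → two F m n N la (swapC la i j) la ∈
        Submodule.span F (f '' {p : Fin N × Fin N | IsCircle la p.1 p.2}) :=
      fun i j h => Submodule.subset_span ⟨(i, j), h, rfl⟩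
    refine map_le F m n N la la hl hl _ fun v _ ha _ => ?_
    rcases ha with ⟨i, j, hC, rfl⟩ | ⟨d1, d2, hD, hsw⟩
    · exact hf i j hC
    · have h := toKq_rel F m n N (.genIII la v hl d1 d2 hD hsw)
      rw [map_sub, map_zero, sub_eq_zero, map_mul] at h
      have h' : two F m n N la v la = _ := h
      rw [h']
      simp only [finsum_eq_sum_of_fintype, map_sum]
      refine Submodule.sum_mem _ fun i _ => Submodule.sum_mem _ fun j _ => ?_
      split_ifs with hC
      · rw [map_zsmul, map_mul]
        exact zsmul_mem (hf i j hC) _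
      · simp

end Kh
end
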